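/- From the intuitionistic axioms H1, H2, H3, H4, there exist double-negation-free condensed-detachment proofs of each of the formulas D1, D2, and D3. -/

import Mathlib

/-- Propositional formulas built from countably many variables by implication `i`
and negation `n`. -/
inductive Fm : Type
  | var : ℕ → Fm
  | i : Fm → Fm → Fm
  | n : Fm → Fm
  deriving DecidableEq

namespace Fm

/-- Homomorphic extension of a substitution (of formulas for variables). -/
def subst (σ : ℕ → Fm) : Fm → Fm
  | var k => σ k
  | i a b => i (subst σ a) (subst σ b)
  | n a => n (subst σ a)

/-- The (finite) set of variables occurring in a formula. -/
def vars : Fm → Finset ℕ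
  | var k => {k}
  | i a b => vars a ∪ vars b
  | n a => vars a

/-- `Sub s t` : `s` is a (not necessarily proper) subformula of `t`. -/
inductive Sub : Fm → Fm → Prop
  | refl (t : Fm) : Sub t t
  | il {s a b : Fm} : Sub s a → Sub s (i a b)
  | ir {s a b : Fm} : Sub s b → Sub s (i a b)
  | neg {s a : Fm} : Sub s a → Sub s (n a)

end Fm

/-- The renaming substitution induced by a permutation of the variables. -/
def renameSubst (p : Equiv.Perm ℕ) : ℕ → Fm := fun k => Fm.var (p k)

/-- `AlphVar A B` : `B` is an alphabetic variant of `A`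
(obtained from `A` by an injective renaming of variables). -/
def AlphVar (A B : Fm) : Prop := ∃ p : Equiv.Perm ℕ, B = A.subst (renameSubst p)

/-- `σ` unifies `A` and `C`. -/
def Unifies (σ : ℕ → Fm) (A C : Fm) : Prop := A.subst σ = C.subst σ

/-- `σ` is a most general unifier of `A` and `C`. -/
def IsMGU (σ : ℕ → Fm) (A C : Fm) : Prop :=
  Unifies σ A C ∧ ∀ τ : ℕ → Fm, Unifies τ A C → ∃ ρ : ℕ → Fm, ∀ k, τ k = (σ k).subst ρ

/-- Condensed detachment: from the major premiss `maj = i(A,B)` and minor premiss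
`minor` (renamed to `C`, sharing no variables with the major premiss), if `σ` is a
most general unifier of `A` and `C`, conclude `Bσ` (up to renaming of variables). -/
def CD (maj minor concl : Fm) : Prop :=
  ∃ (A B C : Fm) (σ : ℕ → Fm),
    maj = Fm.i A B ∧ AlphVar minor C ∧ Disjoint (Fm.i A B).vars C.vars ∧
    IsMGU σ A C ∧ AlphVar (B.subst σ) concl

/-- A formula contains a double negation if it has a subformula of the form `n(n(t))`. -/
def ContainsDN (A : Fm) : Prop := ∃ t : Fm, Fm.Sub (Fm.n (Fm.n t)) A

/-- Existence of a condensed-detachment proof from axiom set `L` in which every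
*deduced* (non-axiom) step satisfies the predicate `allowed`.  A step is an
alphabetic variant of an axiom of `L` or follows from two earlier steps by
condensed detachment. -/
inductive CDProof (L : Set Fm) (allowed : Fm → Prop) : Fm → Prop
  | ax {a b : Fm} : a ∈ L → AlphVar a b → CDProof L allowed b
  | cd {p q c : Fm} : CDProof L allowed p → CDProof L allowed q → CD p q c → allowed c →
      CDProof L allowed c

/-- `B` is provable from `L` by condensed detachment. -/
def CDProvable (L : Set Fm) (B : Fm) : Prop := CDProof L (fun _ => True) B

/-- A formula is double-negation free. -/
def DNFree (f : Fm) : Prop := ¬ ContainsDN f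

/-- `B` has a double-negation-free condensed-detachment proof from `L`
(no deduced step contains a double negation). -/
def DNFreeCDProvable (L : Set Fm) (B : Fm) : Prop := CDProof L DNFree B

/-- Every doubly negated subformula of `f` is (an alphabetic variant of) a doubly
negated subformula of `B`. -/
def DNOk (B : Fm) : Fm → Prop := fun f =>
  ∀ t : Fm, Fm.Sub (Fm.n (Fm.n t)) f → ∃ s : Fm, Fm.Sub (Fm.n (Fm.n s)) B ∧ AlphVar s t

/-- Existence of a proof from axioms `L` and (variable-free) assumptions `Δ` using
modus ponens and substitution, in which every deduced step satisfies `allowed`. -/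
inductive HProof (L Δ : Set Fm) (allowed : Fm → Prop) : Fm → Prop
  | ax {a : Fm} : a ∈ L → HProof L Δ allowed a
  | hyp {a : Fm} : a ∈ Δ → HProof L Δ allowed a
  | mp {a b : Fm} : HProof L Δ allowed (Fm.i a b) → HProof L Δ allowed a → allowed b →
      HProof L Δ allowed b
  | subst {a : Fm} (σ : ℕ → Fm) : HProof L Δ allowed a → allowed (a.subst σ) →
      HProof L Δ allowed (a.subst σ)

/-- Existence of a proof by modus ponens only from the set `S` of premisses, in which
every deduced step satisfies `allowed`. -/
inductive MPProof (S : Set Fm) (allowed : Fm → Prop) : Fm → Prop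
  | prem {a : Fm} : a ∈ S → MPProof S allowed a
  | mp {a b : Fm} : MPProof S allowed (Fm.i a b) → MPProof S allowed a → allowed b →
      MPProof S allowed b

/-- The set of substitution instances of members of `L`. -/
def SubstInstances (L : Set Fm) : Set Fm := {b | ∃ a ∈ L, ∃ σ : ℕ → Fm, b = a.subst σ}

/-- A formula containing no variables. -/
def VarFree (A : Fm) : Prop := A.vars = ∅

/-- Replace all occurrences of the selected doubly negated subformulas `n(n(q))`
(`q ∈ S`) by `q`. -/
def eraseDN (S : Finset Fm) : Fm → Fm
  | .var k => .var k
  | .i a b => .i (eraseDN S a) (eraseDN S b)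
  | .n (.var k) => .n (.var k)
  | .n (.i a b) => .n (.i (eraseDN S a) (eraseDN S b))
  | .n (.n q) => if q ∈ S then eraseDN S q else .n (eraseDN S (.n q))

/-- `L` admits strong double-negation elimination: whenever `B` is provable from `L`
by condensed detachment and `B*` is obtained from `B` by erasing all occurrences of
a chosen set of doubly negated subformulas of `B`, then `B*` has a condensed-detachment
proof from `L` whose deduced steps contain no doubly negated subformulas other than
(alphabetic variants of) those occurring in `B*`. -/
def StrongDNE (L : Set Fm) : Prop :=
  ∀ (B : Fm) (S : Finset Fm), CDProvable L B → (∀ q ∈ S, Fm.Sub (.n (.n q)) B) →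
    CDProof L (DNOk (eraseDN S B)) (eraseDN S B)

/-- Replace every occurrence of the variable `v` by `n(v)` and cancel the resulting
double negations. -/
def flipNeg (v : ℕ) : Fm → Fm
  | .var k => if k = v then .n (.var v) else .var k
  | .i a b => .i (flipNeg v a) (flipNeg v b)
  | .n a => if a = .var v then .var v else .n (flipNeg v a)

/-- Membership in `L*`: the closure of `L` under the operation of replacing a
negated variable `x` (i.e. one with `n(x)` occurring) everywhere by `n(x)`,
cancelling resulting double negations. -/
inductive StarMem (L : Set Fm) : Fm → Prop
  | base {a : Fm} : a ∈ L → StarMem L a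
  | step {a : Fm} {v : ℕ} : StarMem L a → Fm.Sub (.n (.var v)) a → StarMem L (flipNeg v a)

/-- D1 = i(x,x) -/
def D1 : Fm := .i (.var 0) (.var 0)
/-- D2 = i(i(x,x),i(n(x),n(x))) -/
def D2 : Fm := .i (.i (.var 0) (.var 0)) (.i (.n (.var 0)) (.n (.var 0)))
/-- D3 = i(i(x,x),i(i(y,y),i(i(x,y),i(x,y)))) -/
def D3 : Fm := .i (.i (.var 0) (.var 0))
  (.i (.i (.var 1) (.var 1)) (.i (.i (.var 0) (.var 1)) (.i (.var 0) (.var 1))))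

/-- L1 = i(i(x,y),i(i(y,z),i(x,z))) -/
def L1 : Fm := .i (.i (.var 0) (.var 1)) (.i (.i (.var 1) (.var 2)) (.i (.var 0) (.var 2)))
/-- L2 = i(i(n(x),x),x) -/
def L2 : Fm := .i (.i (.n (.var 0)) (.var 0)) (.var 0)
/-- L3 = i(x,i(n(x),y)) -/
def L3 : Fm := .i (.var 0) (.i (.n (.var 0)) (.var 1))
/-- L4 = i(i(x,n(x)),n(x)) -/
def L4 : Fm := .i (.i (.var 0) (.n (.var 0))) (.n (.var 0))
/-- L5 = i(n(x),i(x,y)) -/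
def L5 : Fm := .i (.n (.var 0)) (.i (.var 0) (.var 1))
/-- The Łukasiewicz axiom system for two-valued propositional calculus. -/
def Lax : Set Fm := {L1, L2, L3}

/-- A1 = i(x,i(y,x)) -/
def A1 : Fm := .i (.var 0) (.i (.var 1) (.var 0))
/-- A2 = i(i(x,y),i(i(y,z),i(x,z))) -/
def A2 : Fm := .i (.i (.var 0) (.var 1)) (.i (.i (.var 1) (.var 2)) (.i (.var 0) (.var 2)))
/-- A3 = i(i(i(x,y),y),i(i(y,x),x)) -/
def A3 : Fm := .i (.i (.i (.var 0) (.var 1)) (.var 1)) (.i (.i (.var 1) (.var 0)) (.var 0))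
/-- A4 = i(i(n(x),n(y)),i(y,x)) -/
def A4 : Fm := .i (.i (.n (.var 0)) (.n (.var 1))) (.i (.var 1) (.var 0))
/-- A6 = i(i(x,y),i(n(y),n(x))) -/
def A6 : Fm := .i (.i (.var 0) (.var 1)) (.i (.n (.var 1)) (.n (.var 0)))
/-- A7 = i(i(n(x),y),i(n(y),x)) -/
def A7 : Fm := .i (.i (.n (.var 0)) (.var 1)) (.i (.n (.var 1)) (.var 0))
/-- A8 = i(i(x,n(y)),i(y,n(x))) -/
def A8 : Fm := .i (.i (.var 0) (.n (.var 1))) (.i (.var 1) (.n (.var 0)))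
/-- The axiom system of Łukasiewicz's infinite-valued sentential calculus. -/
def Aax : Set Fm := {A1, A2, A3, A4}

/-- H1 = i(x,i(y,x)) -/
def H1 : Fm := .i (.var 0) (.i (.var 1) (.var 0))
/-- H2 = i(i(x,i(y,z)),i(i(x,y),i(x,z))) -/
def H2 : Fm := .i (.i (.var 0) (.i (.var 1) (.var 2)))
  (.i (.i (.var 0) (.var 1)) (.i (.var 0) (.var 2)))
/-- H3 = i(i(x,n(x)),n(x)) -/
def H3 : Fm := .i (.i (.var 0) (.n (.var 0))) (.n (.var 0))
/-- H4 = i(x,i(n(x),y)) -/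
def H4 : Fm := .i (.var 0) (.i (.n (.var 0)) (.var 1))
/-- The intuitionistic axiom system H. -/
def Hax : Set Fm := {H1, H2, H3, H4}

namespace Fm

theorem subst_subst (σ ρ : ℕ → Fm) (a : Fm) :
    (a.subst σ).subst ρ = a.subst fun k => (σ k).subst ρ := by
  induction a <;> simp_all [subst]

theorem subst_var (a : Fm) : a.subst var = a := by
  induction a <;> simp_all [subst]

theorem subst_congr {σ τ : ℕ → Fm} {a : Fm} (h : ∀ k ∈ a.vars, σ k = τ k) :
    a.subst σ = a.subst τ := by
  induction a with
  | var k => exact h k (by simp [vars])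
  | i a b iha ihb =>
    simp only [vars, Finset.mem_union] at h
    simp [subst, iha fun k hk => h k (.inl hk), ihb fun k hk => h k (.inr hk)]
  | n a ih => simp [subst, ih h]

/-- The variables of a formula, from left to right, with repetitions. -/
def varList : Fm → List ℕ
  | var k => [k]
  | i a b => varList a ++ varList b
  | n a => varList a

/-- Boolean test for the absence of double negations. -/
def dnFreeBool : Fm → Bool
  | var _ => true
  | i a b => dnFreeBool a && dnFreeBool b
  | n (n _) => false
  | n a => dnFreeBool a

theorem dnFree_of_dnFreeBool {f : Fm} (h : f.dnFreeBool = true) : DNFree f := by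
  rintro ⟨t, ht⟩
  induction ht with
  | refl => simp [dnFreeBool] at h
  | il _ ih => exact ih (by simp_all [dnFreeBool])
  | ir _ ih => exact ih (by simp_all [dnFreeBool])
  | @neg a _ ih =>
    refine ih ?_
    cases a <;> simp_all [dnFreeBool]

/-- The substitution replacing the single variable `x` by `t`. -/
def single (x : ℕ) (t : Fm) (k : ℕ) : Fm := if k = x then t else var k

theorem subst_single_of_notMem {x : ℕ} {s t : Fm} (h : x ∉ t.vars) :
    t.subst (single x s) = t := by
  conv_rhs => rw [← subst_var t]
  exact subst_congr fun k hk => if_neg (by rintro rfl; exact h hk)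

theorem single_subst {x : ℕ} {t : Fm} {τ : ℕ → Fm} (h : τ x = t.subst τ) (k : ℕ) :
    (single x t k).subst τ = τ k := by
  unfold single
  split_ifs with hk
  · rw [hk, h]
  · rfl

theorem subst_single_subst {x : ℕ} {t : Fm} {τ : ℕ → Fm} (h : τ x = t.subst τ) (a : Fm) :
    (a.subst (single x t)).subst τ = a.subst τ := by
  rw [subst_subst]
  exact subst_congr fun k _ => single_subst h k

/-- Apply a substitution to both sides of every equation of a list. -/
def substEqs (σ : ℕ → Fm) (E : List (Fm × Fm)) : List (Fm × Fm) :=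
  E.map fun e => (e.1.subst σ, e.2.subst σ)

/-- Robinson unification of a list of equations, with a bound on the number of steps. -/
def unify : ℕ → List (Fm × Fm) → Option (ℕ → Fm)
  | 0, _ => none
  | _ + 1, [] => some var
  | m + 1, (var x, t) :: E =>
    if t = var x then unify m E
    else if x ∈ t.vars then none
    else (unify m (substEqs (single x t) E)).map fun σ k => (single x t k).subst σ
  | m + 1, (t, var x) :: E => unify m ((var x, t) :: E)
  | m + 1, (i a b, i c d) :: E => unify m ((a, c) :: (b, d) :: E)
  | m + 1, (n a, n b) :: E => unify m ((a, b) :: E)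
  | _, _ => none

/-- `σ` is an idempotent most general unifier of the equations `E`. -/
def IsIdemMGU (σ : ℕ → Fm) (E : List (Fm × Fm)) : Prop :=
  (∀ e ∈ E, Unifies σ e.1 e.2) ∧
    ∀ τ, (∀ e ∈ E, Unifies τ e.1 e.2) → ∀ k, (σ k).subst τ = τ k

theorem IsIdemMGU.of_iff {σ : ℕ → Fm} {E E' : List (Fm × Fm)} (h : IsIdemMGU σ E)
    (hE : ∀ τ, (∀ e ∈ E, Unifies τ e.1 e.2) ↔ ∀ e ∈ E', Unifies τ e.1 e.2) :
    IsIdemMGU σ E' :=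
  ⟨(hE σ).1 h.1, fun τ hτ => h.2 τ ((hE τ).2 hτ)⟩

theorem IsIdemMGU.cons_var {σ : ℕ → Fm} {E : List (Fm × Fm)} {x : ℕ} {t : Fm}
    (h : IsIdemMGU σ (substEqs (single x t) E)) (hx : x ∉ t.vars) :
    IsIdemMGU (fun k => (single x t k).subst σ) ((var x, t) :: E) := by
  refine ⟨?_, fun τ hτ k => ?_⟩
  · simp only [List.forall_mem_cons, Unifies, ← subst_subst]
    refine ⟨by simp [subst_single_of_notMem hx, subst, single], fun e he => ?_⟩
    exact h.1 _ (List.mem_map_of_mem he)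
  · rw [List.forall_mem_cons] at hτ
    have hxt : τ x = t.subst τ := hτ.1
    have hσ : ∀ k, (σ k).subst τ = τ k := by
      refine h.2 τ fun e' he' => ?_
      obtain ⟨e, he, rfl⟩ := List.mem_map.1 he'
      simpa only [Unifies, subst_single_subst hxt] using hτ.2 e he
    simp only [subst_subst, hσ, single_subst hxt]

theorem isIdemMGU_of_unify {m : ℕ} {E : List (Fm × Fm)} {σ : ℕ → Fm}
    (h : unify m E = some σ) : IsIdemMGU σ E := by
  fun_induction unify m E generalizing σ with
  | case1 => simp at h
  | case2 =>
    obtain rfl := Option.some.inj h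
    exact ⟨by simp, fun τ _ k => rfl⟩
  | case3 m x E ih => exact (ih h).of_iff fun τ => by simp [Unifies]
  | case4 => simp at h
  | case5 m x t E _ hx ih =>
    obtain ⟨σ, hσ, rfl⟩ := Option.map_eq_some_iff.1 h
    exact (ih hσ).cons_var hx
  | case6 m t x E _ ih => exact (ih h).of_iff fun τ => by simp [Unifies, eq_comm]
  | case7 m a b c d E ih =>
    exact (ih h).of_iff fun τ => by simp [Unifies, subst, and_assoc]
  | case8 m a b E ih => exact (ih h).of_iff fun τ => by simp [Unifies, subst]
  | case9 => simp at h

/-- A renaming of the variables of `f` to initial variables, in order of appearance. -/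
def canonPerm (f : Fm) : Equiv.Perm ℕ :=
  f.varList.dedup.zipIdx.foldl (fun p e => Equiv.swap (p e.1) e.2 * p) 1

end Fm

/-- The permutation exchanging `k` and `k + 8` for `k < 8`. -/
def shiftPerm : Equiv.Perm ℕ :=
  (List.range 8).foldl (fun p k => Equiv.swap k (k + 8) * p) 1

/-- Condensed detachment, returning a result only if it is free of double negations. -/
def detach : Fm → Fm → Option Fm
  | .i A B, q =>
    let C := q.subst (renameSubst shiftPerm)
    if Disjoint (Fm.i A B).vars C.vars then
      (Fm.unify 64 [(A, C)]).bind fun σ =>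
        let D := B.subst σ
        let c := D.subst (renameSubst D.canonPerm)
        if c.dnFreeBool then some c else none
    else none
  | _, _ => none

theorem cd_of_detach {p q c : Fm} (h : detach p q = some c) : CD p q c ∧ DNFree c := by
  unfold detach at h
  split at h
  · rename_i A B
    dsimp only at h
    split_ifs at h with hdisj
    obtain ⟨σ, hσ, h⟩ := Option.bind_eq_some_iff.1 h
    simp only [Option.ite_none_right_eq_some, Option.some.injEq] at h
    obtain ⟨hdn, rfl⟩ := h
    have hm := Fm.isIdemMGU_of_unify hσ
    exact ⟨⟨A, B, _, σ, rfl, ⟨_, rfl⟩, hdisj,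
      ⟨hm.1 _ (List.mem_singleton_self _),
        fun τ hτ => ⟨τ, fun k => (hm.2 τ (by simpa using hτ) k).symm⟩⟩, ⟨_, rfl⟩⟩,
      Fm.dnFree_of_dnFreeBool hdn⟩
  · simp at h

/-- Proof terms for condensed detachment from the axioms `H1`, `H2`, `H3`, `H4`. -/
inductive DTerm : Type
  | h1 | h2 | h3 | h4
  | app : DTerm → DTerm → DTerm

namespace DTerm

/-- The formula proved by a proof term, if every detachment succeeds without
introducing a double negation. -/
def eval : DTerm → Option Fm
  | h1 => some H1
  | h2 => some H2
  | h3 => some H3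
  | h4 => some H4
  | app s t => s.eval.bind fun p => t.eval.bind fun q => detach p q

theorem provable_of_eval {t : DTerm} {f : Fm} (h : t.eval = some f) :
    DNFreeCDProvable Hax f := by
  have hax {a : Fm} (ha : a ∈ Hax) : DNFreeCDProvable Hax a :=
    .ax ha ⟨1, (Fm.subst_var a).symm⟩
  induction t generalizing f with
  | h1 => obtain rfl := Option.some.inj h; exact hax (by simp [Hax])
  | h2 => obtain rfl := Option.some.inj h; exact hax (by simp [Hax])
  | h3 => obtain rfl := Option.some.inj h; exact hax (by simp [Hax])
  | h4 => obtain rfl := Option.some.inj h; exact hax (by simp [Hax])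
  | app s t ihs iht =>
    obtain ⟨p, hp, h⟩ := Option.bind_eq_some_iff.1 h
    obtain ⟨q, hq, h⟩ := Option.bind_eq_some_iff.1 h
    obtain ⟨hcd, hdn⟩ := cd_of_detach h
    exact .cd (ihs hp) (iht hq) hcd hdn

/-- The combinator `λ x, x`. -/
def id : DTerm := app (app h2 h1) h1

/-- `s` applied to the value of `t`, under one abstraction. -/
def comp (s t : DTerm) : DTerm := app (app h2 (app h1 s)) t

/-- The combinator `λ f g x, f (g x)`. -/
def b : DTerm := comp h2 h1

/-- The combinator `λ f x, f (f x)`. -/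
def twice : DTerm := app (app h2 b) id

/-- A proof term for `D2`, compiled from `λ f k, h3 (λ a, h4 (f (f a)) k)`. -/
def d2 : DTerm :=
  comp (app h2 (app h1 h3)) (app (app h2 (comp h2 (comp h1 (comp h2 (comp (app h2 (app h1 h4)) twice))))) (app h1 h1))

/-- A proof term for `D3`, compiled from `λ f g h a, g (g (h (f (f a))))`. -/
def d3 : DTerm :=
  comp (app h2 (comp h2 (comp h1 b))) (comp (app h2 (comp h2 (comp h1 b))) (comp h1 (comp (app h2 b) (comp h1 twice))))

end DTerm

/-- From the intuitionistic axioms H1-H4 there exist double-negation-free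
condensed-detachment proofs of D1, D2, and D3. -/
theorem stmt15 :
    DNFreeCDProvable Hax D1 ∧ DNFreeCDProvable Hax D2 ∧ DNFreeCDProvable Hax D3 := by
  exact ⟨DTerm.provable_of_eval (t := .id) (by decide +kernel),
    DTerm.provable_of_eval (t := .d2) (by decide +kernel),
    DTerm.provable_of_eval (t := .d3) (by decide +kernel)⟩
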